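/- arXiv:2202.13511 — 6 statements merged into one kernel-verified Lean document; each statement's English description precedes it below -/
import Mathlib

section
/- Let G be a finite simple graph, S ⊆ V a connected set, and (S_l, S_r) an ordered CCP-pair of S. Then there exists a single block B of G[S] such that every edge of G[S] with one endpoint in S_l and the other endpoint in S_r has both of its endpoints in B. -/
open SimpleGraph

variable {V : Type*}

/-- `(Sl, Sr)` is an ordered CCP-pair of `S` in graph `G`. -/
def CCP (G : SimpleGraph V) (S Sl Sr : Set V) : Prop :=
  Sl.Nonempty ∧ Sr.Nonempty ∧ Sl ∩ Sr = ∅ ∧ Sl ∪ Sr = S ∧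
  (G.induce Sl).Connected ∧ (G.induce Sr).Connected ∧
  ∃ a ∈ Sl, ∃ b ∈ Sr, G.Adj a b

/-- `B` is a block (maximal nonseparable subgraph) of `G[S]`. -/
def IsBlock (G : SimpleGraph V) (S B : Set V) : Prop :=
  B ⊆ S ∧ 2 ≤ B.ncard ∧ (G.induce B).Connected ∧
  (∀ v ∈ B, (G.induce (B \ {v})).Connected) ∧
  ∀ B' : Set V, B ⊆ B' → B' ⊆ S → 2 ≤ B'.ncard → (G.induce B').Connected →
    (∀ v ∈ B', (G.induce (B' \ {v})).Connected) → B' = B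

/-- `grow G X Y` is the set of vertices of `Y` reachable in `G[Y]` from some vertex of `X`. -/
def grow (G : SimpleGraph V) (X Y : Set V) : Set V :=
  {y | ∃ hy : y ∈ Y, ∃ x, ∃ hx : x ∈ Y, x ∈ X ∧ (G.induce Y).Reachable ⟨x, hx⟩ ⟨y, hy⟩}

/-- `B` is a nonseparable vertex set with at least two elements. -/
def Nonseparable (G : SimpleGraph V) (B : Set V) : Prop :=
  B.Nontrivial ∧ (G.induce B).Connected ∧ ∀ v, (G.induce (B \ {v})).Connected

/-- Attaching a path to a connected set `T` by both ends leaves a graph which stays connected when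
a vertex outside `T` is removed. -/
theorem connected_induce_path_union_diff {G : SimpleGraph V} {a a' b b' v : V} {T : Set V}
    {p : G.Walk a a'} (hp : p.IsPath) (hT : (G.induce T).Connected) (hb : b ∈ T) (hb' : b' ∈ T)
    (hab : G.Adj a b) (hab' : G.Adj a' b') (hv : v ∉ T) :
    (G.induce (({x | x ∈ p.support} ∪ T) \ {v})).Connected := by
  classical
  have hTv : T ⊆ ({x | x ∈ p.support} ∪ T) \ {v} := fun x hx =>
    ⟨Or.inr hx, fun h => hv (h ▸ hx)⟩
  refine G.induce_connected_of_patches b (hTv hb) fun {x} hx => ?_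
  obtain ⟨hx | hx, hxv⟩ := hx
  · change x ∈ p.support at hx
    by_cases hvt : v ∈ (p.takeUntil x hx).support
    · have hvd : v ∉ (p.dropUntil x hx).support := by
        intro hvd
        have hnodup := hp.support_nodup
        rw [← p.take_spec hx, Walk.support_append] at hnodup
        rw [Walk.mem_support_iff] at hvd
        exact hvd.elim (fun h => hxv h.symm)
          (fun h => (List.nodup_append'.mp hnodup).2.2 hvt h)
      refine ⟨{y | y ∈ (p.dropUntil x hx).support} ∪ T, ?_, Or.inr hb,
        Or.inl (Walk.start_mem_support _), ?_⟩
      · refine Set.union_subset (fun y hy => ⟨Or.inl ?_, fun h => hvd (h ▸ hy)⟩) hTv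
        exact p.support_dropUntil_subset_support hx hy
      · exact (connected_induce_union (p.dropUntil x hx).connected_induce_support.preconnected
          hT.preconnected (Walk.end_mem_support _) hb' hab').preconnected _ _
    · refine ⟨{y | y ∈ (p.takeUntil x hx).support} ∪ T, ?_, Or.inr hb,
        Or.inl (Walk.end_mem_support _), ?_⟩
      · refine Set.union_subset (fun y hy => ⟨Or.inl ?_, fun h => hvt (h ▸ hy)⟩) hTv
        exact p.support_takeUntil_subset_support hx hy
      · exact (connected_induce_union (p.takeUntil x hx).connected_induce_support.preconnected
          hT.preconnected (Walk.start_mem_support _) hb hab).preconnected _ _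
  · exact ⟨T, hTv, hb, hx, hT.preconnected _ _⟩

/-- Two disjoint paths whose first and last vertices are respectively adjacent span a
nonseparable set. -/
theorem nonseparable_union_support {G : SimpleGraph V} {a a' b b' : V} {p : G.Walk a a'}
    {q : G.Walk b b'} (hp : p.IsPath) (hq : q.IsPath) (hpq : ∀ x ∈ p.support, x ∉ q.support)
    (hab : G.Adj a b) (hab' : G.Adj a' b') :
    Nonseparable G ({x | x ∈ p.support} ∪ {x | x ∈ q.support}) := by
  refine ⟨⟨a, Or.inl p.start_mem_support, b, Or.inr q.start_mem_support, hab.ne⟩,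
    connected_induce_union p.connected_induce_support.preconnected
      q.connected_induce_support.preconnected p.start_mem_support q.start_mem_support hab,
    fun v => ?_⟩
  by_cases hv : v ∈ q.support
  · rw [Set.union_comm]
    exact connected_induce_path_union_diff hq p.connected_induce_support p.start_mem_support
      p.end_mem_support hab.symm hab'.symm fun h => hpq v h hv
  · exact connected_induce_path_union_diff hp q.connected_induce_support q.start_mem_support
      q.end_mem_support hab hab' hv

theorem Nonseparable.union {G : SimpleGraph V} {B C : Set V} (hB : Nonseparable G B)
    (hC : Nonseparable G C) (h : (B ∩ C).Nontrivial) : Nonseparable G (B ∪ C) := by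
  refine ⟨hB.1.mono Set.subset_union_left, induce_union_connected hB.2.1.preconnected
    hC.2.1.preconnected h.nonempty, fun v => ?_⟩
  rw [Set.union_sdiff_distrib]
  obtain ⟨x, hx, hxv⟩ := h.exists_ne v
  exact induce_union_connected (hB.2.2 v).preconnected (hC.2.2 v).preconnected
    ⟨x, ⟨hx.1, hxv⟩, hx.2, hxv⟩

theorem exists_isPath_support_subset {G : SimpleGraph V} {T : Set V}
    (hT : (G.induce T).Connected) {a b : V} (ha : a ∈ T) (hb : b ∈ T) :
    ∃ p : G.Walk a b, p.IsPath ∧ ∀ x ∈ p.support, x ∈ T := by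
  obtain ⟨p, hp⟩ := (hT.preconnected ⟨a, ha⟩ ⟨b, hb⟩).exists_isPath
  let f : G.induce T →g G := (Embedding.induce T).toHom
  refine ⟨p.map f, hp.map Subtype.val_injective, fun x hx => ?_⟩
  replace hx : x ∈ (p.map f).support := hx
  rw [Walk.support_map, List.mem_map] at hx
  obtain ⟨y, -, rfl⟩ := hx
  exact y.2

theorem isBlock_of_maximal [Finite V] {G : SimpleGraph V} {S B : Set V}
    (h : Maximal (fun C => C ⊆ S ∧ Nonseparable G C) B) : IsBlock G S B := by
  obtain ⟨hBS, hnt, hconn, hdiff⟩ := h.prop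
  refine ⟨hBS, (Set.one_lt_ncard_iff_nontrivial).mpr hnt, hconn, fun v _ => hdiff v,
    fun B' hBB' hB'S hcard hB' hdiff' => (h.eq_of_subset ⟨hB'S, ?_, hB', fun v => ?_⟩ hBB').symm⟩
  · exact (Set.one_lt_ncard_iff_nontrivial).mp hcard
  · by_cases hv : v ∈ B'
    · exact hdiff' v hv
    · rwa [Set.sdiff_singleton_eq_self hv]

/-- If `S` is connected and `(Sl, Sr)` is an ordered CCP-pair of `S`, then
there is a single block `B` of `G[S]` containing both endpoints of every edge of `G[S]`
between `Sl` and `Sr`. -/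
theorem stmt3 [Fintype V] (G : SimpleGraph V) (S Sl Sr : Set V)
    (hconn : (G.induce S).Connected) (hCCP : CCP G S Sl Sr) :
    ∃ B : Set V, IsBlock G S B ∧
      ∀ a b : V, G.Adj a b → a ∈ Sl → b ∈ Sr → a ∈ B ∧ b ∈ B := by
  obtain ⟨-, -, hdisj, hunion, hl, hr, a₀, ha₀, b₀, hb₀, hab₀⟩ := hCCP
  have key : ∀ a b, G.Adj a b → a ∈ Sl → b ∈ Sr →
      ∃ C : Set V, (C ⊆ S ∧ Nonseparable G C) ∧ a₀ ∈ C ∧ b₀ ∈ C ∧ a ∈ C ∧ b ∈ C := by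
    intro a b hab ha hb
    obtain ⟨p, hp, hpl⟩ := exists_isPath_support_subset hl ha₀ ha
    obtain ⟨q, hq, hqr⟩ := exists_isPath_support_subset hr hb₀ hb
    refine ⟨_, ⟨?_, nonseparable_union_support hp hq (fun x hx hx' => ?_) hab₀ hab⟩,
      Or.inl p.start_mem_support, Or.inr q.start_mem_support,
      Or.inl p.end_mem_support, Or.inr q.end_mem_support⟩
    · exact hunion ▸ Set.union_subset_union hpl hqr
    · exact (hdisj ▸ (⟨hpl x hx, hqr x hx'⟩ : x ∈ Sl ∩ Sr) : x ∈ (∅ : Set V))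
  obtain ⟨C₀, hC₀, haC₀, hbC₀, -, -⟩ := key a₀ b₀ hab₀ ha₀ hb₀
  obtain ⟨B, hC₀B, hB⟩ :=
    Finite.exists_le_maximal (p := fun C => C ⊆ S ∧ Nonseparable G C) hC₀
  refine ⟨B, isBlock_of_maximal hB, fun a b hab ha hb => ?_⟩
  obtain ⟨C, hC, haC, hbC, haC', hbC'⟩ := key a b hab ha hb
  have hBC : B ∪ C ⊆ B := hB.le_of_ge
    ⟨Set.union_subset hB.prop.1 hC.1, hB.prop.2.union hC.2
      ⟨a₀, ⟨hC₀B haC₀, haC⟩, b₀, ⟨hC₀B hbC₀, hbC⟩, hab₀.ne⟩⟩ Set.subset_union_left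
  exact ⟨hBC (Or.inr haC'), hBC (Or.inr hbC')⟩
end

section
/- Let G be a finite simple graph, S ⊆ V a connected set, (S_l, S_r) an ordered CCP-pair of S, and B the block of G[S] containing (both endpoints of) every edge of G[S] between S_l and S_r. Then the sets lb := S_l ∩ B and rb := S_r ∩ B are nonempty and disjoint, lb ∪ rb = B, both G[lb] and G[rb] are connected, and G has an edge joining a vertex of lb to a vertex of rb; that is, (lb, rb) is an ordered CCP-pair of B. -/
open SimpleGraph

variable {V : Type*}

/-- A block contains every path of `G[S]` between two of its vertices. -/
theorem IsBlock.support_subset [Finite V] {G : SimpleGraph V} {S B : Set V} (hB : IsBlock G S B)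
    {x y : V} (hx : x ∈ B) (hy : y ∈ B) (p : G.Walk x y) (hp : p.IsPath)
    (hpS : ∀ z ∈ p.support, z ∈ S) : ∀ z ∈ p.support, z ∈ B := by
  classical
  obtain ⟨hBS, hcard, hcon, hcut, hmax⟩ := hB
  have hcut' : ∀ v, (G.induce (B \ {v})).Connected := by
    intro v
    by_cases hv : v ∈ B
    · exact hcut v hv
    · rwa [Set.sdiff_singleton_eq_self hv]
  have key : B ∪ {z | z ∈ p.support} = B := by
    refine hmax _ Set.subset_union_left (Set.union_subset hBS hpS)
      (hcard.trans (Set.ncard_le_ncard Set.subset_union_left (Set.toFinite _)))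
      (induce_union_connected hcon.preconnected
        p.connected_induce_support.preconnected ⟨x, hx, p.start_mem_support⟩) ?_
    intro v _
    obtain ⟨⟨c, hc⟩⟩ := (hcut' v).nonempty
    refine induce_connected_of_patches c ⟨Or.inl hc.1, hc.2⟩ ?_
    rintro z ⟨hz, hzv⟩
    have patch : ∀ {u w : V} (q : G.Walk u w), v ∉ q.support → (∀ t ∈ q.support, t ∈ p.support) →
        z ∈ q.support → (∃ t ∈ q.support, t ∈ B) →
        ∃ s' ⊆ (B ∪ {z | z ∈ p.support}) \ {v}, ∃ (hu' : c ∈ s') (hv' : z ∈ s'),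
          (G.induce s').Reachable ⟨c, hu'⟩ ⟨z, hv'⟩ := by
      rintro u w q hvq hqp hzq ⟨t, htq, htB⟩
      refine ⟨B \ {v} ∪ {z | z ∈ q.support}, ?_, Or.inl hc, Or.inr hzq, ?_⟩
      · rintro a (ha | ha)
        · exact ⟨Or.inl ha.1, ha.2⟩
        · exact ⟨Or.inr (hqp a ha), fun h => hvq (h ▸ ha)⟩
      · exact (induce_union_connected (hcut' v).preconnected
          q.connected_induce_support.preconnected
          ⟨t, ⟨htB, fun h => hvq (h ▸ htq)⟩, htq⟩).preconnected _ _
    rcases hz with hz | hz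
    · exact ⟨B \ {v}, fun a ha => ⟨Or.inl ha.1, ha.2⟩, hc, ⟨hz, hzv⟩, (hcut' v).preconnected _ _⟩
    · have hz : z ∈ p.support := hz
      by_cases h1 : v ∈ (p.takeUntil z hz).support
      · refine patch (p.dropUntil z hz) ?_ (p.support_dropUntil_subset_support hz)
          (Walk.start_mem_support _) ⟨y, Walk.end_mem_support _, hy⟩
        intro h2
        have hn := hp.support_nodup
        rw [← p.take_spec hz, Walk.support_append, List.nodup_append] at hn
        rw [← Walk.cons_tail_support, List.mem_cons] at h2
        rcases h2 with h2 | h2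
        · exact hzv h2.symm
        · exact hn.2.2 v h1 v h2 rfl
      · exact patch (p.takeUntil z hz) h1 (p.support_takeUntil_subset_support hz)
          (Walk.end_mem_support _) ⟨x, Walk.start_mem_support _, hx⟩
  intro z hz
  rw [← key]
  exact Or.inr hz

/-- A connected subset of `S` that meets a block of `G[S]` meets it in a connected set. -/
theorem IsBlock.inter_connected [Finite V] {G : SimpleGraph V} {S B T : Set V}
    (hB : IsBlock G S B) (hTS : T ⊆ S) (hT : (G.induce T).Connected) (hne : (T ∩ B).Nonempty) :
    (G.induce (T ∩ B)).Connected := by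
  classical
  obtain ⟨c, hcT, hcB⟩ := hne
  refine induce_connected_of_patches c ⟨hcT, hcB⟩ ?_
  rintro z ⟨hzT, hzB⟩
  obtain ⟨w⟩ := hT.preconnected ⟨c, hcT⟩ ⟨z, hzT⟩
  let q : G.Walk c z := w.map (Embedding.induce T).toHom
  have hq : ∀ t ∈ q.bypass.support, t ∈ T := by
    intro t ht
    have ht' : t ∈ q.support := q.support_bypass_subset_support ht
    rw [show q.support = _ from Walk.support_map .., List.mem_map] at ht'
    obtain ⟨a, -, rfl⟩ := ht'
    exact a.2
  have hqB := hB.support_subset hcB hzB q.bypass q.bypass_isPath fun t ht => hTS (hq t ht)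
  exact ⟨{t | t ∈ q.bypass.support}, fun t ht => ⟨hq t ht, hqB t ht⟩,
    Walk.start_mem_support _, Walk.end_mem_support _,
    q.bypass.connected_induce_support.preconnected _ _⟩

/-- If `S` is connected, `(Sl, Sr)` is an ordered CCP-pair of `S`, and `B`
is the block of `G[S]` containing every edge of `G[S]` between `Sl` and `Sr`, then
`(Sl ∩ B, Sr ∩ B)` is an ordered CCP-pair of `B`. -/
theorem stmt4 [Fintype V] (G : SimpleGraph V) (S Sl Sr B : Set V)
    (hconn : (G.induce S).Connected) (hCCP : CCP G S Sl Sr)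
    (hB : IsBlock G S B)
    (hBedges : ∀ a b : V, G.Adj a b → a ∈ Sl → b ∈ Sr → a ∈ B ∧ b ∈ B) :
    CCP G B (Sl ∩ B) (Sr ∩ B) := by
  obtain ⟨-, -, hdisj, hunion, hl, hr, a, ha, b, hb, hab⟩ := hCCP
  obtain ⟨haB, hbB⟩ := hBedges a b hab ha hb
  refine ⟨⟨a, ha, haB⟩, ⟨b, hb, hbB⟩, ?_, ?_,
    hB.inter_connected (hunion ▸ Set.subset_union_left) hl ⟨a, ha, haB⟩,
    hB.inter_connected (hunion ▸ Set.subset_union_right) hr ⟨b, hb, hbB⟩,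
    a, ⟨ha, haB⟩, b, ⟨hb, hbB⟩, hab⟩
  · rw [← Set.inter_inter_distrib_right, hdisj, Set.empty_inter]
  · rw [← Set.union_inter_distrib_right, hunion, Set.inter_eq_right]
    exact hB.1
end

section
/- Let G be a finite simple graph, S ⊆ V a connected set, (S_l, S_r) an ordered CCP-pair of S, B the block of G[S] containing every edge of G[S] between S_l and S_r, and set lb := S_l ∩ B, rb := S_r ∩ B. Then S_l = grow(lb, S \ rb) and S_r = grow(rb, S \ lb); that is, S_l is exactly the set of vertices of S \ rb reachable from lb in G[S \ rb], and symmetrically for S_r. -/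
open SimpleGraph

variable {V : Type*}

/-- If `L` is connected and meets `B`, and `B` contains every vertex of `R` adjacent to `L`, then
`L` is what grows from `L ∩ B` inside `S \ (R ∩ B)`, where `S` is the disjoint union of `L`, `R`. -/
theorem eq_grow_of_connected (G : SimpleGraph V) {S L R B : Set V} (hdisj : L ∩ R = ∅)
    (hunion : L ∪ R = S) (hL : (G.induce L).Connected) {a : V} (haL : a ∈ L) (haB : a ∈ B)
    (hB : ∀ u w : V, G.Adj u w → u ∈ L → w ∈ R → w ∈ B) :
    L = grow G (L ∩ B) (S \ (R ∩ B)) := by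
  have hsub : L ⊆ S \ (R ∩ B) := fun y hy =>
    ⟨hunion ▸ Or.inl hy, fun h => (hdisj ▸ ⟨hy, h.1⟩ : y ∈ (∅ : Set V))⟩
  ext y
  constructor
  · intro hy
    refine ⟨hsub hy, a, hsub haL, ⟨haL, haB⟩, ?_⟩
    exact (hL.preconnected ⟨a, haL⟩ ⟨y, hy⟩).map (G.induceHomOfLE hsub).toHom
  · rintro ⟨hy, x, hx, ⟨hxL, -⟩, ⟨p⟩⟩
    have closed : ∀ u v : ↥(S \ (R ∩ B)), (G.induce (S \ (R ∩ B))).Walk u v →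
        (u : V) ∈ L → (v : V) ∈ L := by
      intro u v p
      induction p with
      | nil => exact id
      | @cons u w v h _ ih =>
        intro hu
        refine ih ?_
        have hw : (w : V) ∈ L ∪ R := hunion ▸ w.2.1
        exact hw.resolve_right fun hwR => w.2.2 ⟨hwR, hB u w h hu hwR⟩
    exact closed _ _ p hxL

/-- With `B` the block containing every edge between `Sl` and `Sr`, and
`lb := Sl ∩ B`, `rb := Sr ∩ B`, we have `Sl = grow(lb, S \ rb)` and `Sr = grow(rb, S \ lb)`. -/
theorem stmt5 [Fintype V] (G : SimpleGraph V) (S Sl Sr B : Set V)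
    (hconn : (G.induce S).Connected) (hCCP : CCP G S Sl Sr)
    (hB : IsBlock G S B)
    (hBedges : ∀ a b : V, G.Adj a b → a ∈ Sl → b ∈ Sr → a ∈ B ∧ b ∈ B) :
    Sl = grow G (Sl ∩ B) (S \ (Sr ∩ B)) ∧ Sr = grow G (Sr ∩ B) (S \ (Sl ∩ B)) := by
  obtain ⟨-, -, hdisj, hunion, hl, hr, a, ha, b, hb, hab⟩ := hCCP
  obtain ⟨haB, hbB⟩ := hBedges a b hab ha hb
  exact ⟨eq_grow_of_connected G hdisj hunion hl ha haB
      fun u w h hu hw => (hBedges u w h hu hw).2,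
    eq_grow_of_connected G (Set.inter_comm Sl Sr ▸ hdisj) (Set.union_comm Sl Sr ▸ hunion) hr hb hbB
      fun u w h hu hw => (hBedges w u h.symm hw hu).1⟩
end

section
/- Let G be a finite simple graph, S ⊆ V a connected set, B a block of G[S], and (lb, rb) an ordered CCP-pair of B. Define S_l := grow(lb, S \ rb) and S_r := S \ S_l. Then (S_l, S_r) is an ordered CCP-pair of S. -/
open SimpleGraph

variable {V : Type*}

theorem reachable_induce_mono {G : SimpleGraph V} {X Y : Set V} (h : X ⊆ Y) {a b : X}
    (hab : (G.induce X).Reachable a b) :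
    (G.induce Y).Reachable ⟨a, h a.2⟩ ⟨b, h b.2⟩ :=
  hab.map (G.induceHomOfLE h).toHom

/-- A property that holds at `a` and spreads along the edges of `G[Y]` holds at every vertex
reachable from `a` in `G[Y]`. -/
theorem induce_reachable_induction {G : SimpleGraph V} {Y : Set V} {P : Y → Prop} {a b : Y}
    (hab : (G.induce Y).Reachable a b) (ha : P a)
    (step : ∀ u w : Y, G.Adj u w → P u → P w) : P b := by
  obtain ⟨p⟩ := hab
  induction p with
  | nil => exact ha
  | cons h _ ih => exact ih (step _ _ h ha)

theorem grow_subset (G : SimpleGraph V) (X Y : Set V) : grow G X Y ⊆ Y := fun _ h => h.1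

theorem subset_grow (G : SimpleGraph V) {X Y : Set V} (h : X ⊆ Y) : X ⊆ grow G X Y :=
  fun x hx => ⟨h hx, x, h hx, hx, Reachable.refl _⟩

theorem mem_grow_of_adj {G : SimpleGraph V} {X Y : Set V} {u w : V} (hu : u ∈ grow G X Y)
    (hw : w ∈ Y) (huw : G.Adj u w) : w ∈ grow G X Y := by
  obtain ⟨hy, x, hx, hxX, hr⟩ := hu
  have hadj : (G.induce Y).Adj ⟨u, hy⟩ ⟨w, hw⟩ := huw
  exact ⟨hw, x, hx, hxX, hr.trans hadj.reachable⟩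

theorem grow_connected {G : SimpleGraph V} {X Y : Set V} (h : X ⊆ Y)
    (hX : (G.induce X).Connected) : (G.induce (grow G X Y)).Connected := by
  obtain ⟨⟨x₀, hx₀⟩⟩ := hX.nonempty
  have hsub := subset_grow G h
  refine connected_iff_exists_forall_reachable _ |>.2 ⟨⟨x₀, hsub hx₀⟩, ?_⟩
  rintro ⟨y, hy, x, hx, hxX, hr⟩
  obtain ⟨_, h'⟩ := induce_reachable_induction
    (P := fun z => ∃ hz : z.1 ∈ grow G X Y,
      (G.induce (grow G X Y)).Reachable ⟨x₀, hsub hx₀⟩ ⟨z.1, hz⟩) hr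
    ⟨hsub hxX, reachable_induce_mono hsub (hX.preconnected ⟨x₀, hx₀⟩ ⟨x, hxX⟩)⟩ (by
      rintro u w huw ⟨hu, hru⟩
      have hw := mem_grow_of_adj hu w.2 huw
      have hadj : (G.induce (grow G X Y)).Adj ⟨u, hu⟩ ⟨w, hw⟩ := huw
      exact ⟨hw, hru.trans hadj.reachable⟩)
  exact h'

theorem diff_grow_connected {G : SimpleGraph V} {S X R : Set V} (hR : R ⊆ S)
    (hS : (G.induce S).Connected) (hRc : (G.induce R).Connected) :
    (G.induce (S \ grow G X (S \ R))).Connected := by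
  obtain ⟨⟨r, hr⟩⟩ := hRc.nonempty
  have hsub : R ⊆ S \ grow G X (S \ R) :=
    fun z hz => ⟨hR hz, fun hg => (grow_subset G _ _ hg).2 hz⟩
  refine connected_iff_exists_forall_reachable _ |>.2 ⟨⟨r, hsub hr⟩, ?_⟩
  rintro ⟨y, hy⟩
  refine induce_reachable_induction
    (P := fun z => ∀ hz : z.1 ∈ S \ grow G X (S \ R),
      (G.induce (S \ grow G X (S \ R))).Reachable ⟨r, hsub hr⟩ ⟨z.1, hz⟩)
    (hS.preconnected ⟨r, hR hr⟩ ⟨y, hy.1⟩) (fun _ => Reachable.refl _) ?_ hy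
  intro u w huw hu hw
  by_cases hug : u.1 ∈ grow G X (S \ R)
  · have hwR : w.1 ∈ R := by
      by_contra hwR
      exact hw.2 (mem_grow_of_adj hug ⟨w.2, hwR⟩ huw)
    exact reachable_induce_mono hsub (hRc.preconnected ⟨r, hr⟩ ⟨w, hwR⟩)
  · have hadj : (G.induce (S \ grow G X (S \ R))).Adj ⟨u, u.2, hug⟩ ⟨w, hw⟩ := huw
    exact (hu ⟨u.2, hug⟩).trans hadj.reachable

/-- If `S` is connected, `B` is a block of `G[S]`, and `(lb, rb)` is an
ordered CCP-pair of `B`, then `(grow(lb, S \ rb), S \ grow(lb, S \ rb))` is an ordered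
CCP-pair of `S`. -/
theorem stmt6 [Fintype V] (G : SimpleGraph V) (S B lb rb : Set V)
    (hconn : (G.induce S).Connected) (hB : IsBlock G S B)
    (hpair : CCP G B lb rb) :
    CCP G S (grow G lb (S \ rb)) (S \ grow G lb (S \ rb)) := by
  obtain ⟨hl, hr, hdisj, hun, hlc, hrc, a, ha, b, hb, hab⟩ := hpair
  have hlS : lb ⊆ S \ rb := fun x hx =>
    ⟨hB.1 (hun ▸ Or.inl hx), fun hxr => Set.notMem_empty x (hdisj ▸ ⟨hx, hxr⟩)⟩
  have hrS : rb ⊆ S := fun x hx => hB.1 (hun ▸ Or.inr hx)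
  have hrsub : rb ⊆ S \ grow G lb (S \ rb) :=
    fun z hz => ⟨hrS hz, fun hg => (grow_subset G _ _ hg).2 hz⟩
  exact ⟨hl.mono (subset_grow G hlS), hr.mono hrsub, Set.inter_sdiff_self _ _,
    Set.union_sdiff_cancel ((grow_subset G _ _).trans Set.sdiff_subset),
    grow_connected hlS hlc, diff_grow_connected hrS hconn hrc,
    a, subset_grow G hlS ha, b, hrsub hb, hab⟩
end

section
/- Let G be a finite simple graph and S ⊆ V a connected set. Suppose B and B' are blocks of G[S], (lb, rb) is an ordered CCP-pair of B, and (lb', rb') is an ordered CCP-pair of B'. If grow(lb, S \ rb) = grow(lb', S \ rb'), then B = B', lb = lb', and rb = rb'. In other words, each ordered CCP-pair of S is produced by the grow construction from exactly one triple (block, lb, rb). -/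
open SimpleGraph

variable {V : Type*}

/-- Adding an ear (a path with both ends in `B`) to a nonseparable set `B` keeps it nonseparable. -/
theorem connected_union_support_diff (G : SimpleGraph V) {B : Set V}
    (hB : ∀ v, (G.induce (B \ {v})).Connected) {x y : V} (hx : x ∈ B) (hy : y ∈ B)
    (p : G.Walk x y) (hp : p.IsPath) (v : V) :
    (G.induce ((B ∪ {w | w ∈ p.support}) \ {v})).Connected := by
  obtain ⟨⟨u, hu⟩⟩ := (hB v).nonempty
  refine G.induce_connected_of_patches u ⟨Or.inl hu.1, hu.2⟩ ?_
  have patch : ∀ {z w : V} (q : G.Walk z w), q.support ⊆ p.support → z ∈ B → v ∉ q.support →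
      ∃ s' ⊆ (B ∪ {w | w ∈ p.support}) \ {v}, ∃ (hu' : u ∈ s') (hw' : w ∈ s'),
        (G.induce s').Reachable ⟨u, hu'⟩ ⟨w, hw'⟩ := by
    intro z w q hq hz hv
    have hne : ∀ t ∈ q.support, t ≠ v := fun t ht h => hv (h ▸ ht)
    refine ⟨B \ {v} ∪ {t | t ∈ q.support}, ?_, Or.inl hu, Or.inr q.end_mem_support, ?_⟩
    · rintro t (ht | ht)
      · exact ⟨Or.inl ht.1, ht.2⟩
      · exact ⟨Or.inr (hq ht), hne t ht⟩
    · exact induce_union_connected (hB v).preconnected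
        q.connected_induce_support.preconnected
        ⟨z, ⟨hz, hne z q.start_mem_support⟩, q.start_mem_support⟩ _ _
  rintro w ⟨hw | hw, hwv⟩
  · exact ⟨B \ {v}, fun t ht => ⟨Or.inl ht.1, ht.2⟩, hu, ⟨hw, hwv⟩, (hB v) _ _⟩
  · obtain ⟨q, r, rfl⟩ := Walk.mem_support_iff_exists_append.1 hw
    by_cases hvq : v ∈ q.support
    · refine patch r.reverse (by simp [Walk.support_append_eq_support_dropLast_append]) hy ?_
      intro hvr
      rw [Walk.support_reverse, List.mem_reverse] at hvr
      exact hp.ne_of_mem_support_of_append (fun h => hwv h.symm) hvq hvr rfl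
    · exact patch q (by simp [Walk.support_append]) hx hvq

/-- Deleting any vertex of `V` from a block leaves a connected set. -/
theorem IsBlock.connected_diff {G : SimpleGraph V} {S B : Set V} (hB : IsBlock G S B) (v : V) :
    (G.induce (B \ {v})).Connected := by
  by_cases hv : v ∈ B
  · exact hB.2.2.2.1 v hv
  · rw [Set.sdiff_singleton_eq_self hv]
    exact hB.2.2.1

/-- A superset of a block inside `S` without cut vertices is that block. -/
theorem IsBlock.eq_of_subset [Finite V] {G : SimpleGraph V} {S B T : Set V} (hB : IsBlock G S B)
    (hBT : B ⊆ T) (hTS : T ⊆ S) (hT : ∀ v, (G.induce (T \ {v})).Connected) : T = B := by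
  have hcard : 2 ≤ T.ncard := hB.2.1.trans (Set.ncard_le_ncard hBT T.toFinite)
  refine hB.2.2.2.2 T hBT hTS hcard ?_ fun v _ => hT v
  obtain ⟨a, ha, b, hb, hab⟩ := (Set.one_lt_ncard T.toFinite).1 hcard
  by_cases hT2 : ∃ c ∈ T, c ≠ a ∧ c ≠ b
  · obtain ⟨c, hc, hca, hcb⟩ := hT2
    have hT_eq : T = T \ {a} ∪ T \ {b} := by ext; grind
    rw [hT_eq]
    exact induce_union_connected (hT a).preconnected (hT b).preconnected
      ⟨c, ⟨hc, hca⟩, ⟨hc, hcb⟩⟩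
  · have : B = T := Set.eq_of_subset_of_ncard_le hBT (by
      have : T = {a, b} := by ext; grind
      rw [this, Set.ncard_pair hab]; exact hB.2.1) T.toFinite
    exact this ▸ hB.2.2.1

/-- Two blocks sharing two distinct vertices coincide. -/
theorem IsBlock.eq_of_mem_inter [Finite V] {G : SimpleGraph V} {S B B' : Set V}
    (hB : IsBlock G S B) (hB' : IsBlock G S B') {a b : V} (hab : a ≠ b)
    (ha : a ∈ B) (ha' : a ∈ B') (hb : b ∈ B) (hb' : b ∈ B') : B = B' := by
  have hU : ∀ v, (G.induce ((B ∪ B') \ {v})).Connected := by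
    intro v
    rw [Set.union_sdiff_distrib]
    refine induce_union_connected (hB.connected_diff v).preconnected
      (hB'.connected_diff v).preconnected ?_
    by_cases hav : a = v
    · exact ⟨b, ⟨hb, fun h => hab (hav.trans h.symm)⟩, ⟨hb', fun h => hab (hav.trans h.symm)⟩⟩
    · exact ⟨a, ⟨ha, hav⟩, ⟨ha', hav⟩⟩
  have hS := Set.union_subset hB.1 hB'.1
  rw [← hB.eq_of_subset Set.subset_union_left hS hU]
  exact hB'.eq_of_subset Set.subset_union_right hS hU

theorem grow_inter_eq {G : SimpleGraph V} {S B lb rb : Set V} (hBS : B ⊆ S)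
    (hpair : CCP G B lb rb) : grow G lb (S \ rb) ∩ B = lb := by
  obtain ⟨-, -, hdisj, hunion, -⟩ := hpair
  ext w
  constructor
  · rintro ⟨⟨hw, -⟩, hwB⟩
    exact (hunion ▸ hwB : w ∈ lb ∪ rb).resolve_right hw.2
  · intro hw
    have hwB : w ∈ B := hunion ▸ Or.inl hw
    have hwY : w ∈ S \ rb := ⟨hBS hwB, fun h => (hdisj ▸ ⟨hw, h⟩ : w ∈ (∅ : Set V))⟩
    exact ⟨⟨hwY, w, hwY, hw, Reachable.refl _⟩, hwB⟩

/-- Every edge of `G[S]` leaving `grow G lb (S \ rb)` lies in the block `lb ∪ rb`. -/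
theorem mem_block_of_adj_grow [Finite V] {G : SimpleGraph V} {S B lb rb : Set V}
    (hB : IsBlock G S B) (hpair : CCP G B lb rb) {a b : V} (ha : a ∈ grow G lb (S \ rb))
    (hbS : b ∈ S) (hb : b ∉ grow G lb (S \ rb)) (hab : G.Adj a b) : a ∈ B ∧ b ∈ B := by
  obtain ⟨haY, x, hxY, hx, hreach⟩ := ha
  have hunion := hpair.2.2.2.1
  have hbr : b ∈ rb := by
    by_contra hbr
    have hstep : (G.induce (S \ rb)).Adj ⟨a, haY⟩ ⟨b, hbS, hbr⟩ := hab
    exact hb ⟨⟨hbS, hbr⟩, x, hxY, hx, hreach.trans hstep.reachable⟩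
  have hxB : x ∈ B := hunion ▸ Or.inl hx
  have hbB : b ∈ B := hunion ▸ Or.inr hbr
  obtain ⟨p, hp⟩ := hreach.symm.exists_isPath
  let q : G.Walk a x := p.map (Embedding.induce (S \ rb)).toHom
  have hqpath : q.IsPath := hp.map Subtype.val_injective
  have hqY : ∀ w ∈ q.support, w ∈ S \ rb := by
    intro w hw
    obtain ⟨t, -, rfl⟩ := List.mem_map.1 (Walk.support_map _ p ▸ hw)
    exact t.2
  have hpath : (Walk.cons hab.symm q).IsPath := hqpath.cons fun h => (hqY b h).2 hbr
  have hT := hB.eq_of_subset Set.subset_union_left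
    (Set.union_subset hB.1 fun w hw => ?_)
    (connected_union_support_diff G hB.connected_diff hbB hxB _ hpath)
  · refine ⟨hT ▸ Or.inr ?_, hbB⟩
    simp
  · rcases List.mem_cons.1 (Walk.support_cons hab.symm q ▸ hw) with rfl | hw
    · exact hbS
    · exact (hqY w hw).1

/-- The grow construction is injective on triples `(B, lb, rb)` where `B`
is a block of `G[S]` and `(lb, rb)` is an ordered CCP-pair of `B`. -/
theorem stmt9 [Fintype V] (G : SimpleGraph V) (S B B' lb rb lb' rb' : Set V)
    (hconn : (G.induce S).Connected)
    (hB : IsBlock G S B) (hB' : IsBlock G S B')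
    (hpair : CCP G B lb rb) (hpair' : CCP G B' lb' rb')
    (heq : grow G lb (S \ rb) = grow G lb' (S \ rb')) :
    B = B' ∧ lb = lb' ∧ rb = rb' := by
  have h₁ := grow_inter_eq hB.1 hpair
  have h₂ := grow_inter_eq hB'.1 hpair'
  have hBB' : B = B' := by
    obtain ⟨-, -, hdisj, hunion, -, -, a, ha, b, hb, hab⟩ := hpair
    have haB : a ∈ B := hunion ▸ Or.inl ha
    have hbB : b ∈ B := hunion ▸ Or.inr hb
    have haL : a ∈ grow G lb (S \ rb) := (h₁.ge ha).1
    have hbL : b ∉ grow G lb (S \ rb) := fun h => h.1.2 hb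
    have h := mem_block_of_adj_grow hB' hpair' (heq ▸ haL) (hB.1 hbB) (heq ▸ hbL) hab
    exact hB.eq_of_mem_inter hB' hab.ne haB h.1 hbB h.2
  subst hBB'
  have hl : lb = lb' := by rw [← h₁, ← h₂, heq]
  subst hl
  obtain ⟨-, -, hdisj, hunion, -⟩ := hpair
  obtain ⟨-, -, hdisj', hunion', -⟩ := hpair'
  refine ⟨rfl, rfl, ?_⟩
  rw [← Set.disjoint_iff_inter_eq_empty] at hdisj hdisj'
  rw [← hdisj.sup_sdiff_cancel_left, ← hdisj'.sup_sdiff_cancel_left]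
  exact congrArg (· \ lb) (hunion.trans hunion'.symm)
end

section
/- Let G be a finite simple graph and S ⊆ V a connected set with |S| = n ≥ 2. Then the number of ordered CCP-pairs of S is at most Σ_{B block of G[S]} 2^{|B|}, which in turn is at most 2^{n}. -/
open SimpleGraph

variable {V : Type*}

/-- A vertex set induces a connected graph iff it is nonempty and each of its nonempty proper
subsets is joined by an edge to the rest of the set. -/
theorem induce_connected_iff_exists_adj (G : SimpleGraph V) (S : Set V) :
    (G.induce S).Connected ↔ S.Nonempty ∧ ∀ X ⊆ S, X.Nonempty → (S \ X).Nonempty →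
      ∃ a ∈ X, ∃ b ∈ S \ X, G.Adj a b := by
  constructor
  · intro h
    refine ⟨Set.nonempty_coe_sort.mp h.nonempty, ?_⟩
    rintro X hX ⟨x, hx⟩ ⟨y, hyS, hyX⟩
    obtain ⟨w⟩ := h.preconnected ⟨x, hX hx⟩ ⟨y, hyS⟩
    obtain ⟨d, -, h1, h2⟩ := w.exists_boundary_dart {z | (z : V) ∈ X} hx hyX
    exact ⟨d.fst, h1, d.snd, ⟨d.snd.2, h2⟩, d.adj⟩
  · rintro ⟨⟨x, hx⟩, h⟩
    rw [connected_iff_exists_forall_reachable]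
    refine ⟨⟨x, hx⟩, fun y => ?_⟩
    by_contra hy
    obtain ⟨a, ⟨ha, hxa⟩, b, ⟨hb, hxb⟩, hab⟩ :=
      h {z | ∃ hz : z ∈ S, (G.induce S).Reachable ⟨x, hx⟩ ⟨z, hz⟩} (fun z hz => hz.1)
        ⟨x, hx, Reachable.refl _⟩ ⟨y, y.2, fun hz => hy hz.2⟩
    have hadj : (G.induce S).Adj ⟨a, ha⟩ ⟨b, hb⟩ := hab
    exact hxb ⟨hb, hxa.trans hadj.reachable⟩

/-- The vertex `v` separates `S` into the two nonempty sides `C` and `D`. -/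
structure Separates (G : SimpleGraph V) (S : Set V) (v : V) (C D : Set V) : Prop where
  eq_insert : S = insert v (C ∪ D)
  left_nonempty : C.Nonempty
  right_nonempty : D.Nonempty
  disjoint : ∀ x ∈ C, x ∉ D
  notMem_left : v ∉ C
  notMem_right : v ∉ D
  not_adj : ∀ x ∈ C, ∀ y ∈ D, ¬ G.Adj x y

namespace Separates

variable {G : SimpleGraph V} {S C D : Set V} {v : V}

theorem symm (h : Separates G S v C D) : Separates G S v D C where
  eq_insert := by rw [h.eq_insert, Set.union_comm]
  left_nonempty := h.right_nonempty
  right_nonempty := h.left_nonempty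
  disjoint x hD hC := h.disjoint x hC hD
  notMem_left := h.notMem_right
  notMem_right := h.notMem_left
  not_adj x hx y hy hxy := h.not_adj y hy x hx hxy.symm

theorem left_subset (h : Separates G S v C D) : insert v C ⊆ S := by
  rw [h.eq_insert]
  exact Set.insert_subset_insert Set.subset_union_left

theorem subset_or_subset (h : Separates G S v C D) {R : Set V} (hR : R ⊆ S) (hv : v ∉ R)
    (hconn : (G.induce R).Connected) : R ⊆ C ∨ R ⊆ D := by
  by_contra! hcon
  obtain ⟨h1, h2⟩ := hcon
  obtain ⟨x, hx, hxC⟩ := Set.not_subset.mp h1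
  obtain ⟨y, hy, hyD⟩ := Set.not_subset.mp h2
  have hS : ∀ z ∈ R, z ∈ C ∨ z ∈ D := fun z hz => by
    have := hR hz
    rw [h.eq_insert] at this
    grind
  obtain ⟨a, ha, b, hb, hab⟩ := ((induce_connected_iff_exists_adj G R).mp hconn).2 (R ∩ C)
    Set.inter_subset_left ⟨y, hy, (hS y hy).resolve_right hyD⟩ ⟨x, hx, fun hx' => hxC hx'.2⟩
  exact h.not_adj a ha.2 b ((hS b hb.1).resolve_left fun hbC => hb.2 ⟨hb.1, hbC⟩) hab

theorem connected_inter (h : Separates G S v C D) {L : Set V} (hL : L ⊆ S) (hv : v ∈ L)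
    (hconn : (G.induce L).Connected) : (G.induce (L ∩ insert v C)).Connected := by
  have hedge := ((induce_connected_iff_exists_adj G L).mp hconn).2
  have hS : ∀ z ∈ L, z = v ∨ z ∈ C ∨ z ∈ D := fun z hz => by
    have := hL hz
    rw [h.eq_insert] at this
    grind
  have hdisj := h.disjoint
  have hvD := h.notMem_right
  have hadj := h.not_adj
  rw [induce_connected_iff_exists_adj]
  refine ⟨⟨v, hv, Set.mem_insert _ _⟩, fun X hX hne hne' => ?_⟩
  obtain ⟨x, hx⟩ := hne
  obtain ⟨y, hy⟩ := hne'
  by_cases hvX : v ∈ X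
  · obtain ⟨a, ha, b, hb, hab⟩ := hedge (X ∪ (L ∩ D))
      (Set.union_subset (fun z hz => (hX hz).1) Set.inter_subset_left) ⟨x, Or.inl hx⟩
      ⟨y, hy.1.1, by grind⟩
    have hbS := hS b hb.1
    have hbC : b ∈ C := by grind
    refine ⟨a, ?_, b, by grind, hab⟩
    have := hadj b hbC a
    have := hab.symm
    grind
  · obtain ⟨a, ha, b, hb, hab⟩ := hedge X (fun z hz => (hX hz).1) ⟨x, hx⟩ ⟨y, hy.1.1, hy.2⟩
    have haC : a ∈ C := by grind
    have := hadj a haC b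
    have hbS := hS b hb.1
    exact ⟨a, ha, b, by grind, hab⟩

theorem connected_left (h : Separates G S v C D) (hconn : (G.induce S).Connected) :
    (G.induce (insert v C)).Connected := by
  have hv : v ∈ S := h.left_subset (Set.mem_insert _ _)
  have := h.connected_inter subset_rfl hv hconn
  rwa [Set.inter_eq_self_of_subset_right h.left_subset] at this

theorem nonseparable_subset_or_subset (h : Separates G S v C D) {B : Set V} (hB : B ⊆ S)
    (hconn : (G.induce B).Connected) (hdel : ∀ u ∈ B, (G.induce (B \ {u})).Connected) :
    B ⊆ insert v C ∨ B ⊆ insert v D := by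
  have hconn' : (G.induce (B \ {v})).Connected := by
    by_cases hv : v ∈ B
    · exact hdel v hv
    · rwa [Set.sdiff_singleton_eq_self hv]
  simpa [Set.sdiff_singleton_subset_iff] using
    h.subset_or_subset (Set.sdiff_subset.trans hB) (by simp) hconn'

theorem not_subset_right (h : Separates G S v C D) {B : Set V} (hB : B ⊆ insert v C)
    (hcard : 2 ≤ B.ncard) : ¬ B ⊆ insert v D := by
  intro hB'
  have hsub : B ⊆ {v} := fun x hx => by
    have h1 := hB hx
    have h2 := hB' hx
    have := h.disjoint x
    grind
  have := Set.ncard_le_ncard hsub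
  rw [Set.ncard_singleton] at this
  omega

theorem isBlock_of_left (h : Separates G S v C D) {B : Set V} (hB : IsBlock G (insert v C) B) :
    IsBlock G S B := by
  obtain ⟨hBC, hcard, hconn, hdel, hmax⟩ := hB
  refine ⟨hBC.trans h.left_subset, hcard, hconn, hdel, fun B' hBB' hB'S hcard' hconn' hdel' => ?_⟩
  obtain hB' | hB' := h.nonseparable_subset_or_subset hB'S hconn' hdel'
  · exact hmax B' hBB' hB' hcard' hconn' hdel'
  · exact absurd (hBB'.trans hB') (h.not_subset_right hBC hcard)

theorem setOf_isBlock (h : Separates G S v C D) :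
    {B | IsBlock G S B} = {B | IsBlock G (insert v C) B} ∪ {B | IsBlock G (insert v D) B} := by
  ext B
  constructor
  · rintro ⟨hBS, hcard, hconn, hdel, hmax⟩
    exact (h.nonseparable_subset_or_subset hBS hconn hdel).imp
      (fun hB => ⟨hB, hcard, hconn, hdel, fun B' hBB' hB' => hmax B' hBB' (hB'.trans h.left_subset)⟩)
      (fun hB => ⟨hB, hcard, hconn, hdel,
        fun B' hBB' hB' => hmax B' hBB' (hB'.trans h.symm.left_subset)⟩)
  · rintro (hB | hB)
    · exact h.isBlock_of_left hB
    · exact h.symm.isBlock_of_left hB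

theorem disjoint_setOf_isBlock (h : Separates G S v C D) :
    Disjoint {B | IsBlock G (insert v C) B} {B | IsBlock G (insert v D) B} := by
  rw [Set.disjoint_left]
  exact fun B hC hD => h.not_subset_right hC.1 hC.2.1 hD.1

end Separates

theorem CCP.symm {G : SimpleGraph V} {S L R : Set V} (h : CCP G S L R) : CCP G S R L := by
  obtain ⟨hL, hR, hdisj, hunion, hLc, hRc, a, ha, b, hb, hab⟩ := h
  exact ⟨hR, hL, by rw [Set.inter_comm, hdisj], by rw [Set.union_comm, hunion], hRc, hLc,
    b, hb, a, ha, hab.symm⟩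

theorem CCP.notMem_right {G : SimpleGraph V} {S L R : Set V} (h : CCP G S L R) {x : V}
    (hx : x ∈ L) : x ∉ R :=
  fun hx' => Set.eq_empty_iff_forall_notMem.mp h.2.2.1 x ⟨hx, hx'⟩

open Classical in
/-- Enlarge by `D` the component of a pair of sets that contains `v`. -/
noncomputable def extendAt (v : V) (D : Set V) (p : Set V × Set V) : Set V × Set V :=
  if v ∈ p.1 then (p.1 ∪ D, p.2) else (p.1, p.2 ∪ D)

namespace Separates

variable {G : SimpleGraph V} {S C D : Set V} {v : V}

theorem ccp_inter (h : Separates G S v C D) {L R : Set V} (hp : CCP G S L R) (hv : v ∈ L)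
    (hRC : R ⊆ C) : CCP G (insert v C) (L ∩ insert v C) R ∧ L ∩ insert v C ∪ D = L := by
  have hd : ∀ z ∈ L, z ∉ R := fun z => hp.notMem_right
  obtain ⟨-, hR, -, hunion, hLc, hRc, a, ha, b, hb, hab⟩ := hp
  have hS : ∀ z, z ∈ L ∪ R ↔ z = v ∨ z ∈ C ∨ z ∈ D := fun z => by
    rw [hunion, h.eq_insert]; grind
  have hCD := h.disjoint
  have hLS : L ⊆ S := hunion ▸ Set.subset_union_left
  refine ⟨⟨⟨v, hv, Set.mem_insert _ _⟩, hR, ?_, ?_, h.connected_inter hLS hv hLc, hRc,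
    a, ⟨ha, ?_⟩, b, hb, hab⟩, ?_⟩
  · ext z; grind
  · ext z; grind
  · have := h.not_adj b (hRC hb) a
    have := hab.symm
    have := (hS a).mp (Or.inl ha)
    grind
  · ext z; grind

theorem exists_ccp_of_mem (h : Separates G S v C D) {L R : Set V} (hp : CCP G S L R) (hv : v ∈ L) :
    (∃ L', v ∈ L' ∧ CCP G (insert v C) L' R ∧ L' ∪ D = L) ∨
      (∃ L', v ∈ L' ∧ CCP G (insert v D) L' R ∧ L' ∪ C = L) := by
  have hRS : R ⊆ S := hp.2.2.2.1 ▸ Set.subset_union_right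
  obtain hR | hR := h.subset_or_subset hRS (hp.notMem_right hv) hp.2.2.2.2.2.1
  · exact Or.inl ⟨L ∩ insert v C, ⟨hv, Set.mem_insert _ _⟩, h.ccp_inter hp hv hR⟩
  · exact Or.inr ⟨L ∩ insert v D, ⟨hv, Set.mem_insert _ _⟩, h.symm.ccp_inter hp hv hR⟩

theorem setOf_ccp_subset (h : Separates G S v C D) :
    {p : Set V × Set V | CCP G S p.1 p.2} ⊆
      extendAt v D '' {p | CCP G (insert v C) p.1 p.2} ∪
        extendAt v C '' {p | CCP G (insert v D) p.1 p.2} := by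
  rintro ⟨L, R⟩ hp
  have hp' : CCP G S L R := hp
  have hv : v ∈ L ∪ R := hp'.2.2.2.1 ▸ h.left_subset (Set.mem_insert _ _)
  obtain hv | hv := hv
  · obtain ⟨L', hv', hL', rfl⟩ | ⟨L', hv', hL', rfl⟩ := h.exists_ccp_of_mem hp' hv
    · exact Or.inl ⟨(L', R), hL', by simp [extendAt, hv']⟩
    · exact Or.inr ⟨(L', R), hL', by simp [extendAt, hv']⟩
  · obtain ⟨R', hv', hR', rfl⟩ | ⟨R', hv', hR', rfl⟩ := h.exists_ccp_of_mem hp'.symm hv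
    · exact Or.inl ⟨(L, R'), hR'.symm, by simp [extendAt, hR'.notMem_right hv']⟩
    · exact Or.inr ⟨(L, R'), hR'.symm, by simp [extendAt, hR'.notMem_right hv']⟩

end Separates

theorem exists_separates {G : SimpleGraph V} {S : Set V} {v : V} (hv : v ∈ S)
    (hne : (S \ {v}).Nonempty) (hconn : ¬ (G.induce (S \ {v})).Connected) :
    ∃ C D, Separates G S v C D := by
  rw [induce_connected_iff_exists_adj] at hconn
  push Not at hconn
  obtain ⟨C, hCS, hC, hD, hadj⟩ := hconn hne
  refine ⟨C, (S \ {v}) \ C, ?_, hC, hD, fun x hx hx' => hx'.2 hx, fun hvC => (hCS hvC).2 rfl,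
    fun hvD => hvD.1.2 rfl, hadj⟩
  rw [Set.union_sdiff_cancel hCS, Set.insert_sdiff_singleton, Set.insert_eq_of_mem hv]

theorem setOf_isBlock_of_nonseparable {G : SimpleGraph V} {S : Set V} (h2 : 2 ≤ S.ncard)
    (hconn : (G.induce S).Connected) (hdel : ∀ v ∈ S, (G.induce (S \ {v})).Connected) :
    {B | IsBlock G S B} = {S} := by
  ext B
  constructor
  · exact fun hB => (hB.2.2.2.2 S hB.1 subset_rfl h2 hconn hdel).symm
  · rintro rfl
    exact ⟨subset_rfl, h2, hconn, hdel, fun B' h h' _ _ _ => h'.antisymm h⟩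

theorem ncard_setOf_ccp_le [Finite V] (G : SimpleGraph V) (S : Set V) :
    {p : Set V × Set V | CCP G S p.1 p.2}.ncard ≤ 2 ^ S.ncard := by
  have hsub : {p : Set V × Set V | CCP G S p.1 p.2} ⊆ (fun L => (L, S \ L)) '' 𝒫 S := by
    rintro ⟨L, R⟩ ⟨-, -, hdisj, hunion, -⟩
    refine ⟨L, hunion ▸ Set.subset_union_left, ?_⟩
    dsimp only at hdisj hunion ⊢
    rw [← hunion, Set.union_sdiff_cancel_left hdisj.subset]
  calc _ ≤ ((fun L => (L, S \ L)) '' 𝒫 S).ncard := Set.ncard_le_ncard hsub (Set.toFinite _)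
    _ ≤ (𝒫 S).ncard := Set.ncard_image_le (Set.toFinite _)
    _ = 2 ^ S.ncard := Set.ncard_powerset S

theorem two_pow_add_two_pow_le {a b n : ℕ} (ha : 2 ≤ a) (hb : 2 ≤ b) (h : a + b = n + 1) :
    2 ^ a + 2 ^ b ≤ 2 ^ n := by
  have h1 : 2 ^ a ≤ 2 ^ (n - 1) := Nat.pow_le_pow_right two_pos (by omega)
  have h2 : 2 ^ b ≤ 2 ^ (n - 1) := Nat.pow_le_pow_right two_pos (by omega)
  have h3 : 2 ^ n = 2 ^ (n - 1) * 2 := by rw [← pow_succ]; congr 1; omega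
  omega

/-- For connected `S` with `|S| = n ≥ 2`, the number of ordered CCP-pairs
of `S` is at most `Σ_{B block of G[S]} 2^{|B|}`, which is at most `2^n`. -/
theorem stmt13 [Fintype V] (G : SimpleGraph V) (S : Set V) (n : ℕ)
    (hconn : (G.induce S).Connected) (hn : S.ncard = n) (h2 : 2 ≤ n) :
    Nat.card {p : Set V × Set V // CCP G S p.1 p.2} ≤
      ∑ᶠ B ∈ {B : Set V | IsBlock G S B}, 2 ^ B.ncard ∧
    ∑ᶠ B ∈ {B : Set V | IsBlock G S B}, 2 ^ B.ncard ≤ 2 ^ n := by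
  have hcoe : ∀ T : Set V, Nat.card {p : Set V × Set V // CCP G T p.1 p.2} =
      {p : Set V × Set V | CCP G T p.1 p.2}.ncard := fun T => Nat.card_coe_set_eq _
  induction n using Nat.strong_induction_on generalizing S with
  | _ n ih =>
  subst hn
  by_cases hdel : ∀ v ∈ S, (G.induce (S \ {v})).Connected
  · rw [setOf_isBlock_of_nonseparable h2 hconn hdel, finsum_mem_singleton, hcoe]
    exact ⟨ncard_setOf_ccp_le G S, le_rfl⟩
  · push Not at hdel
    obtain ⟨v, hv, hdel⟩ := hdel
    have hne : (S \ {v}).Nonempty := by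
      rw [← Set.ncard_pos (Set.toFinite _), Set.ncard_sdiff_singleton_of_mem hv]
      omega
    obtain ⟨C, D, h⟩ := exists_separates hv hne hdel
    have hC : (insert v C).ncard = C.ncard + 1 := Set.ncard_insert_of_notMem h.notMem_left
    have hD : (insert v D).ncard = D.ncard + 1 := Set.ncard_insert_of_notMem h.notMem_right
    have hS : S.ncard = C.ncard + D.ncard + 1 := by
      rw [h.eq_insert, Set.ncard_insert_of_notMem (by simp [h.notMem_left, h.notMem_right]),
        Set.ncard_union_eq (Set.disjoint_left.mpr h.disjoint)]
    have hC0 : 0 < C.ncard := (Set.ncard_pos (Set.toFinite _)).mpr h.left_nonempty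
    have hD0 : 0 < D.ncard := (Set.ncard_pos (Set.toFinite _)).mpr h.right_nonempty
    obtain ⟨hC1, hC2⟩ := ih _ (by omega) _ (h.connected_left hconn) rfl (by omega)
    obtain ⟨hD1, hD2⟩ := ih _ (by omega) _ (h.symm.connected_left hconn) rfl (by omega)
    rw [hcoe] at hC1 hD1 ⊢
    rw [h.setOf_isBlock, finsum_mem_union h.disjoint_setOf_isBlock (Set.toFinite _) (Set.toFinite _)]
    constructor
    · calc _ ≤ _ := Set.ncard_le_ncard h.setOf_ccp_subset (Set.toFinite _)
        _ ≤ _ := Set.ncard_union_le _ _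
        _ ≤ _ := Nat.add_le_add
          ((Set.ncard_image_le (Set.toFinite _)).trans hC1)
          ((Set.ncard_image_le (Set.toFinite _)).trans hD1)
    · exact (Nat.add_le_add hC2 hD2).trans
        (two_pow_add_two_pow_le (by omega) (by omega) (by omega))
end
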